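/- arXiv:1407.4663 — 3 statements merged into one kernel-verified Lean document; each statement's English description precedes it below -/
import Mathlib

section
/- Every graph with minimum degree δ has two edge-disjoint spanning subgraphs, each with minimum degree at least ⌊(δ-1)/2⌋. -/
open SimpleGraph

/-- A signed simple graph: a symmetric matrix with entries in `{-1, 0, 1}` and zero diagonal. -/
structure IsSigning {V : Type*} (x : V → V → ℤ) : Prop where
  symm : ∀ a b, x a b = x b a
  diag : ∀ a, x a a = 0
  vals : ∀ a b, x a b = 0 ∨ x a b = 1 ∨ x a b = -1

/-- The matrix of the single edge `vu`. -/
def singleEdge {V : Type*} [DecidableEq V] (v u a b : V) : ℤ :=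
  (if a = v ∧ b = u then 1 else 0) + (if a = u ∧ b = v then 1 else 0)

lemma sum_singleEdge {V : Type*} [Fintype V] [DecidableEq V] (v u a : V) :
    ∑ b, singleEdge v u a b = (if a = v then 1 else 0) + (if a = u then 1 else 0) := by
  simp only [singleEdge, Finset.sum_add_distrib, ite_and]
  split_ifs <;> simp

/-- Reversing the signs along a maximal alternating trail that starts at `v` with sign `s`: the
imbalance changes only at `v` and at the end `w` of the trail, whose last edge has sign `t`. For
the empty trail, `w = v` and `t = -s`. -/
lemma exists_alternating_switch {V : Type*} [Fintype V] [DecidableEq V] (x : V → V → ℤ)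
    (hx : IsSigning x) (v : V) (s : ℤ) (hs : s = 1 ∨ s = -1) :
    ∃ (y : V → V → ℤ) (w : V) (t : ℤ), IsSigning y ∧ (∀ a b, (y a b).natAbs = (x a b).natAbs) ∧
      (t = 1 ∨ t = -1) ∧
      (∀ a, ∑ b, y a b =
        ∑ b, x a b - 2 * (if a = v then s else 0) - 2 * (if a = w then t else 0)) ∧
      1 + (if w = v then t * s else 0) ≤ t * ∑ b, x w b := by
  induction hn : ∑ a, ∑ b, (x a b).natAbs using Nat.strong_induction_on generalizing x v s with
  | _ n ih =>
  subst hn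
  by_cases hu : ∃ u, x v u = s
  · obtain ⟨u, hu⟩ := hu
    have huv : u ≠ v := by
      rintro rfl
      have := hx.diag u
      omega
    have hu' : x u v = s := hx.symm u v ▸ hu
    set x₁ : V → V → ℤ := fun a b => x a b - s * singleEdge v u a b with hx₁
    have key : ∀ a b, (singleEdge v u a b = 1 ∧ x a b = s) ∨ singleEdge v u a b = 0 := by
      intro a b
      unfold singleEdge
      by_cases h₁ : a = v ∧ b = u
      · obtain ⟨rfl, rfl⟩ := h₁
        simp [hu, huv]
      · by_cases h₂ : a = u ∧ b = v
        · obtain ⟨rfl, rfl⟩ := h₂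
          simp [hu', huv]
        · simp [h₁, h₂]
    have psymm : ∀ a b, singleEdge v u a b = singleEdge v u b a := by
      intro a b
      simp only [singleEdge, and_comm, add_comm]
    have pdiag : ∀ a, singleEdge v u a a = 0 := by
      intro a
      rcases key a a with h | h
      · have := hx.diag a
        omega
      · exact h
    have hx₁s : IsSigning x₁ := by
      refine ⟨fun a b => ?_, fun a => ?_, fun a b => ?_⟩
      · simp only [hx₁, hx.symm a b, psymm a b]
      · simp [hx₁, hx.diag a, pdiag a]
      · rcases key a b with ⟨h, h'⟩ | h
        · simp [hx₁, h, h']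
        · simpa [hx₁, h] using hx.vals a b
    have hle : ∀ a b, (x₁ a b).natAbs ≤ (x a b).natAbs := by
      intro a b
      rcases key a b with ⟨h, h'⟩ | h <;> simp [hx₁, h, *]
    have hlt : ∑ a, ∑ b, (x₁ a b).natAbs < ∑ a, ∑ b, (x a b).natAbs := by
      refine Finset.sum_lt_sum (fun a _ => Finset.sum_le_sum fun b _ => hle a b)
        ⟨v, Finset.mem_univ _, Finset.sum_lt_sum (fun b _ => hle v b) ⟨u, Finset.mem_univ _, ?_⟩⟩
      have : singleEdge v u v u = 1 := by simp [singleEdge, huv]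
      simp only [hx₁, this, hu]
      omega
    have hsum : ∀ a, ∑ b, x₁ a b =
        ∑ b, x a b - s * ((if a = v then 1 else 0) + (if a = u then 1 else 0)) := by
      intro a
      simp only [hx₁, Finset.sum_sub_distrib, ← Finset.mul_sum, sum_singleEdge]
    obtain ⟨y, w, t, hy, hyx, ht, hD, hw⟩ := ih _ hlt x₁ hx₁s u (-s) (by omega) rfl
    refine ⟨fun a b => y a b - s * singleEdge v u a b, w, t, ⟨fun a b => ?_, fun a => ?_,
      fun a b => ?_⟩, fun a b => ?_, ht, fun a => ?_, ?_⟩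
    · simp only [hy.symm a b, psymm a b]
    · simp [hy.diag a, pdiag a]
    · have h₁ := hyx a b
      rcases key a b with ⟨h, h'⟩ | h
      · simp only [hx₁, h, h', mul_one, sub_self, Int.natAbs_zero] at h₁
        simp only [h]
        omega
      · simpa [h] using hy.vals a b
    · have h₁ := hyx a b
      rcases key a b with ⟨h, h'⟩ | h
      · simp only [hx₁, h, h', mul_one, sub_self, Int.natAbs_zero] at h₁
        simp only [h, h']
        omega
      · simpa [hx₁, h] using h₁
    · simp only [Finset.sum_sub_distrib, ← Finset.mul_sum, sum_singleEdge, hD a, hsum a]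
      split_ifs <;> ring
    · rw [hsum w] at hw
      rcases hs with rfl | rfl <;> rcases ht with rfl | rfl <;> split_ifs at hw ⊢ <;> omega
  · push Not at hu
    refine ⟨x, v, -s, hx, fun _ _ => rfl, by omega, fun a => ?_, ?_⟩
    · split_ifs <;> ring
    · have h : 0 ≤ ∑ b, -s * x v b := by
        refine Finset.sum_nonneg fun b _ => ?_
        have := hu b
        rcases hs with rfl | rfl <;> rcases hx.vals v b with h | h | h <;> simp_all
      rw [← Finset.mul_sum] at h
      rcases hs with rfl | rfl <;> simpa using h

lemma exists_balanced_signing {V : Type*} [Fintype V] [DecidableEq V] (x : V → V → ℤ)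
    (hx : IsSigning x) :
    ∃ y : V → V → ℤ, IsSigning y ∧ (∀ a b, (y a b).natAbs = (x a b).natAbs) ∧
      ∀ a, (∑ b, y a b).natAbs ≤ 2 := by
  induction hn : ∑ a, (∑ b, x a b).natAbs using Nat.strong_induction_on generalizing x with
  | _ n ih =>
  subst hn
  by_cases hbal : ∀ a, (∑ b, x a b).natAbs ≤ 2
  · exact ⟨x, hx, fun _ _ => rfl, hbal⟩
  push Not at hbal
  obtain ⟨v, hv⟩ := hbal
  obtain ⟨s, hs, hsv⟩ : ∃ s : ℤ, (s = 1 ∨ s = -1) ∧ 3 ≤ s * ∑ b, x v b := by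
    rcases le_total 0 (∑ b, x v b) with h | h
    · exact ⟨1, .inl rfl, by omega⟩
    · exact ⟨-1, .inr rfl, by omega⟩
  obtain ⟨y, w, t, hy, hyx, ht, hD, hw⟩ := exists_alternating_switch x hx v s hs
  have hlt : ∑ a, (∑ b, y a b).natAbs < ∑ a, (∑ b, x a b).natAbs := by
    refine Finset.sum_lt_sum (fun a _ => ?_) ⟨v, Finset.mem_univ _, ?_⟩
    · rw [hD a]
      by_cases hav : a = v <;> by_cases haw : a = w <;> by_cases hwv : w = v <;>
        subst_vars <;> rcases hs with rfl | rfl <;> rcases ht with rfl | rfl <;>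
        simp_all <;> omega
    · rw [hD v]
      by_cases hwv : w = v
      · subst hwv
        rcases hs with rfl | rfl <;> rcases ht with rfl | rfl <;> simp at * <;> omega
      · rw [if_pos rfl, if_neg (Ne.symm hwv)]
        rcases hs with rfl | rfl <;> omega
  obtain ⟨z, hz, hzy, hbal⟩ := ih _ hlt y hy rfl
  exact ⟨z, hz, fun a b => (hzy a b).trans (hyx a b), hbal⟩

theorem stmt1 {V : Type*} [Fintype V] (G : SimpleGraph V) (δ : ℕ)
    (hδ : ∀ v : V, δ ≤ (G.neighborSet v).ncard) :
    ∃ H₁ H₂ : SimpleGraph V, H₁ ≤ G ∧ H₂ ≤ G ∧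
      Disjoint H₁.edgeSet H₂.edgeSet ∧
      (∀ v : V, (δ - 1) / 2 ≤ (H₁.neighborSet v).ncard) ∧
      (∀ v : V, (δ - 1) / 2 ≤ (H₂.neighborSet v).ncard) := by
  classical
  obtain ⟨y, hy, hyG, hbal⟩ := exists_balanced_signing (fun a b => if G.Adj a b then (1 : ℤ) else 0)
    ⟨fun a b => by simp only [G.adj_comm], fun a => by simp, fun a b => by split_ifs <;> simp⟩
  have hadj : ∀ a b, y a b ≠ 0 ↔ G.Adj a b := by
    intro a b
    have := hyG a b
    split_ifs at this with h <;> simp only [h] <;> simp at this ⊢ <;> omega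
  let H₁ : SimpleGraph V :=
    { Adj := fun a b => y a b = 1
      symm := ⟨fun a b h => (hy.symm b a).trans h⟩
      loopless := ⟨fun a h => by simp [hy.diag a] at h⟩ }
  let H₂ : SimpleGraph V :=
    { Adj := fun a b => y a b = -1
      symm := ⟨fun a b h => (hy.symm b a).trans h⟩
      loopless := ⟨fun a h => by simp [hy.diag a] at h⟩ }
  have hcard : ∀ (H : SimpleGraph V) (v : V),
      ((H.neighborSet v).ncard : ℤ) = ∑ b, if H.Adj v b then 1 else 0 := by
    intro H v
    rw [Finset.sum_boole, ← Set.ncard_coe_finset]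
    congr 2
    ext b
    simp
  have hdeg : ∀ v, ((G.neighborSet v).ncard : ℤ) =
      (H₁.neighborSet v).ncard + (H₂.neighborSet v).ncard := by
    intro v
    rw [hcard, hcard, hcard, ← Finset.sum_add_distrib]
    refine Finset.sum_congr rfl fun b _ => ?_
    rcases hy.vals v b with h | h | h <;> simp [H₁, H₂, ← hadj, h]
  have hdiff : ∀ v, ∑ b, y v b =
      ((H₁.neighborSet v).ncard : ℤ) - (H₂.neighborSet v).ncard := by
    intro v
    rw [hcard, hcard, ← Finset.sum_sub_distrib]
    refine Finset.sum_congr rfl fun b _ => ?_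
    rcases hy.vals v b with h | h | h <;> simp [H₁, H₂, h]
  refine ⟨H₁, H₂, fun a b h => ?_, fun a b h => ?_, ?_, fun v => ?_, fun v => ?_⟩
  · have h : y a b = 1 := h
    exact (hadj a b).1 (by omega)
  · have h : y a b = -1 := h
    exact (hadj a b).1 (by omega)
  · rw [Set.disjoint_left]
    intro e
    induction e with
    | _ a b =>
      intro (h₁ : y a b = 1) (h₂ : y a b = -1)
      omega
  all_goals
    have h₁ := hδ v
    have h₂ := hdeg v
    have h₃ := hdiff v
    have h₄ := hbal v
    omega
end

section
/- Let k be a positive integer and let t be the integer with 2^t ≤ k < 2^{t+1}, and set s = k - 2^t. Then every graph with minimum degree δ has k pairwise edge-disjoint spanning subgraphs, 2s of which have minimum degree at least (δ - 2^{t+2} + 2)/2^{t+1} and the remaining k - 2s of which have minimum degree at least (δ - 2^{t+1} + 2)/2^t. -/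
open SimpleGraph

/-- A finite type carries an involution preserving the fibres of `f` and with at most one fixed
point in each fibre. -/
theorem exists_involutive_fiber_pairing {E A : Type*} [Finite E] (f : E → A) :
    ∃ σ : Equiv.Perm E, (∀ x, σ (σ x) = x) ∧ (∀ x, f (σ x) = f x) ∧
      ∀ x y, σ x = x → σ y = y → f x = f y → x = y := by
  classical
  have := Fintype.ofFinite E
  suffices h : ∀ S : Finset E, ∃ σ : Equiv.Perm E, (∀ x, σ (σ x) = x) ∧ (∀ x, f (σ x) = f x) ∧
      (∀ x ∉ S, σ x = x) ∧
      ∀ x ∈ S, ∀ y ∈ S, σ x = x → σ y = y → f x = f y → x = y by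
    obtain ⟨σ, h1, h2, -, h3⟩ := h Finset.univ
    exact ⟨σ, h1, h2, fun x y => h3 x (Finset.mem_univ x) y (Finset.mem_univ y)⟩
  intro S
  induction S using Finset.induction_on with
  | empty => exact ⟨1, by simp⟩
  | insert e S he ih =>
    obtain ⟨σ, h1, h2, h3, h4⟩ := ih
    by_cases hy : ∃ y ∈ S, σ y = y ∧ f y = f e
    · obtain ⟨y, hyS, hy, hf⟩ := hy
      have hne : y ≠ e := fun h => he (h ▸ hyS)
      have hse : σ e = e := h3 e he
      have key : ∀ x, (x = e ∧ (σ * Equiv.swap e y) x = y) ∨ (x = y ∧ (σ * Equiv.swap e y) x = e) ∨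
          (x ≠ e ∧ x ≠ y ∧ (σ * Equiv.swap e y) x = σ x) := by
        intro x
        by_cases hxe : x = e
        · subst hxe; simp [hy]
        · by_cases hxy : x = y
          · subst hxy; simp [hse]
          · simp [Equiv.swap_apply_of_ne_of_ne hxe hxy, hxe, hxy]
      generalize σ * Equiv.swap e y = τ at key
      refine ⟨τ, ?_, ?_, ?_, ?_⟩
      · intro x
        have := h1 x
        grind
      · intro x
        have := h2 x
        grind
      · intro x hx
        grind
      · intro x hx z hz
        have := h4 x
        grind
    · push Not at hy
      refine ⟨σ, h1, h2, fun x hx => h3 x fun h => hx (Finset.mem_insert_of_mem h), ?_⟩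
      intro x hx z hz
      grind

/-- Two fixed-point-free involutions admit a common two-colouring that both of them reverse. -/
theorem exists_coloring_of_involutive {X : Type*} [Finite X] (σ τ : Equiv.Perm X)
    (hσ : ∀ x, σ (σ x) = x) (hτ : ∀ x, τ (τ x) = x) (hσ' : ∀ x, σ x ≠ x) (hτ' : ∀ x, τ x ≠ x) :
    ∃ c : X → Bool, (∀ x, c (σ x) = !c x) ∧ ∀ x, c (τ x) = !c x := by
  classical
  have hσi : σ⁻¹ = σ := by
    ext x; rw [Equiv.Perm.inv_eq_iff_eq, hσ]
  have hτi : τ⁻¹ = τ := by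
    ext x; rw [Equiv.Perm.inv_eq_iff_eq, hτ]
  have hconj : ∀ m : ℤ, ∀ x, ((σ * τ) ^ (-m)) (σ x) = σ (((σ * τ) ^ m) x) := by
    intro m x
    have h : σ * (σ * τ) ^ m * σ⁻¹ = (σ * τ) ^ (-m) := by
      rw [← conj_zpow, zpow_neg, ← inv_zpow, mul_inv_rev, hσi, hτi]
      congr 1
      ext x
      simp [hσ]
    rw [← h]
    simp
  have hns : ∀ x, ¬ (σ * τ).SameCycle x (σ x) := by
    rintro x ⟨k, hk⟩
    obtain ⟨m, rfl | rfl⟩ := Int.even_or_odd' k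
    · apply hσ' (((σ * τ) ^ m) x)
      rw [← hconj, ← hk, ← Equiv.Perm.mul_apply, ← zpow_add]
      congr 2
      ring
    · apply hτ' (((σ * τ) ^ m) x)
      have h : ((σ * τ) ^ (m + 1)) x = σ (((σ * τ) ^ m) x) := by
        rw [← hconj, ← hk, ← Equiv.Perm.mul_apply, ← zpow_add]
        congr 2
        ring
      rw [add_comm, zpow_add, zpow_one] at h
      exact σ.injective h
  obtain ⟨n, ⟨e⟩⟩ := Finite.exists_equiv_fin X
  let r : X → Fin n := fun x => e (Quotient.mk (Equiv.Perm.SameCycle.setoid (σ * τ)) x).out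
  have hr : ∀ x y, r x = r y ↔ (σ * τ).SameCycle x y := by
    intro x y
    simp only [r, EmbeddingLike.apply_eq_iff_eq, Quotient.out_inj]
    exact Quotient.eq
  have hrστ : ∀ x, r (σ (τ x)) = r x := fun x =>
    (hr _ _).2 ((Equiv.Perm.sameCycle_apply_left (f := σ * τ)).2 (Equiv.Perm.SameCycle.refl _ _))
  have hrτ : ∀ x, r (τ x) = r (σ x) := fun x => by
    rw [← hrστ (τ x), hτ]
  have hlt : ∀ x, r x ≠ r (σ x) := fun x h => hns x ((hr _ _).1 h)
  refine ⟨fun x => decide (r x < r (σ x)), fun x => ?_, fun x => ?_⟩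
  · have := hlt x
    simp only [hσ]
    rw [← decide_not, decide_eq_decide]
    grind
  · have := hlt x
    simp only [hrστ, hrτ]
    rw [← decide_not, decide_eq_decide]
    grind

/-- Any two involutions of a finite type admit a common two-colouring that changes along each of
their two-element orbits. -/
theorem exists_coloring_of_involutive_of_ne {X : Type*} [Finite X] (σ τ : Equiv.Perm X)
    (hσ : ∀ x, σ (σ x) = x) (hτ : ∀ x, τ (τ x) = x) :
    ∃ c : X → Bool, (∀ x, σ x ≠ x → c (σ x) = !c x) ∧ ∀ x, τ x ≠ x → c (τ x) = !c x := by
  classical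
  have key : ∀ ρ : Equiv.Perm X, (∀ x, ρ (ρ x) = x) → ∃ ρ' : Equiv.Perm (X × Bool),
      (∀ x, ρ' (ρ' x) = x) ∧ (∀ x, ρ' x ≠ x) ∧ ∀ x, ρ x ≠ x → ρ' (x, true) = (ρ x, true) := by
    intro ρ hρ
    have hinv : Function.Involutive
        (fun p : X × Bool => if ρ p.1 = p.1 then (p.1, !p.2) else (ρ p.1, p.2)) := by
      rintro ⟨x, b⟩
      by_cases hx : ρ x = x
      · simp [hx]
      · have : ¬ x = ρ x := fun h => hx h.symm
        simp [hx, hρ, this]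
    refine ⟨hinv.toPerm, hinv, ?_, ?_⟩
    · rintro ⟨x, b⟩
      by_cases hx : ρ x = x <;> simp [hx]
    · intro x hx
      simp [hx]
  obtain ⟨σ', h1, h2, h3⟩ := key σ hσ
  obtain ⟨τ', k1, k2, k3⟩ := key τ hτ
  obtain ⟨c, hc1, hc2⟩ := exists_coloring_of_involutive σ' τ' h1 k1 h2 k2
  refine ⟨fun x => c (x, true), fun x hx => ?_, fun x hx => ?_⟩
  · simp only [← h3 x hx, hc1]
  · simp only [← k3 x hx, hc2]

/-- If a colouring changes along an involution pairing up all but at most one point of each fibre,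
then it is balanced on each fibre. -/
theorem ncard_fiber_le_of_pairing {E A : Type*} [Finite E] (f : E → A) (σ : Equiv.Perm E)
    (hf : ∀ x, f (σ x) = f x) (hfix : ∀ x y, σ x = x → σ y = y → f x = f y → x = y)
    (c : E → Bool) (hc : ∀ x, σ x ≠ x → c (σ x) = !c x) (a : A) (b : Bool) :
    {x | f x = a ∧ c x = b}.ncard ≤ {x | f x = a ∧ c x = !b}.ncard + 1 := by
  have hsub : {x | f x = a ∧ c x = b} ⊆
      σ ⁻¹' {x | f x = a ∧ c x = !b} ∪ {x | f x = a ∧ σ x = x} := by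
    rintro x ⟨rfl, rfl⟩
    by_cases hx : σ x = x
    · exact Or.inr ⟨rfl, hx⟩
    · exact Or.inl ⟨hf x, hc x hx⟩
  have h1 : (σ ⁻¹' {x | f x = a ∧ c x = !b}).ncard = {x | f x = a ∧ c x = !b}.ncard :=
    Set.ncard_preimage_of_injective_subset_range σ.injective (by simp)
  have h2 : {x | f x = a ∧ σ x = x}.ncard ≤ 1 := by
    rw [Set.ncard_le_one]
    rintro x ⟨hx, hx'⟩ y ⟨hy, hy'⟩
    exact hfix x y hx' hy' (hx.trans hy.symm)
  calc _ ≤ _ := Set.ncard_le_ncard hsub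
    _ ≤ _ := Set.ncard_union_le _ _
    _ ≤ _ := by omega

/-- The edges of a finite bipartite multigraph, with `f` and `g` the two endpoint maps, have a
two-colouring that is balanced at every vertex. -/
theorem exists_balanced_coloring {E A B : Type*} [Finite E] (f : E → A) (g : E → B) :
    ∃ c : E → Bool,
      (∀ a b, {x | f x = a ∧ c x = b}.ncard ≤ {x | f x = a ∧ c x = !b}.ncard + 1) ∧
      ∀ a b, {x | g x = a ∧ c x = b}.ncard ≤ {x | g x = a ∧ c x = !b}.ncard + 1 := by
  obtain ⟨σ, h1, h2, h3⟩ := exists_involutive_fiber_pairing f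
  obtain ⟨τ, k1, k2, k3⟩ := exists_involutive_fiber_pairing g
  obtain ⟨c, hc1, hc2⟩ := exists_coloring_of_involutive_of_ne σ τ h1 k1
  exact ⟨c, ncard_fiber_le_of_pairing f σ h2 h3 c hc1, ncard_fiber_le_of_pairing g τ k2 k3 c hc2⟩

/-- The pairs of a finite relation have a two-colouring balanced on every row and column. -/
theorem exists_balanced_coloring_rel {A B : Type*} [Finite A] [Finite B] (R : A → B → Prop) :
    ∃ c : A → B → Bool,
      (∀ x b, {y | R x y ∧ c x y = b}.ncard ≤ {y | R x y ∧ c x y = !b}.ncard + 1) ∧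
      ∀ y b, {x | R x y ∧ c x y = b}.ncard ≤ {x | R x y ∧ c x y = !b}.ncard + 1 := by
  obtain ⟨c, h1, h2⟩ := exists_balanced_coloring
    (fun p : A × B => (p.1, R p.1 p.2)) (fun p : A × B => (p.2, R p.1 p.2))
  refine ⟨fun x y => c (x, y), fun x b => ?_, fun y b => ?_⟩
  · have key : ∀ b, {p : A × B | (p.1, R p.1 p.2) = (x, True) ∧ c p = b}.ncard =
        {y | R x y ∧ c (x, y) = b}.ncard := by
      intro b
      rw [← Set.ncard_image_of_injective {y | R x y ∧ c (x, y) = b}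
        (Prod.mk_right_injective x)]
      refine congrArg Set.ncard (Set.ext fun ⟨u, v⟩ => ?_)
      simp only [Set.mem_ofPred_eq, Set.mem_image, Prod.mk.injEq, eq_iff_iff, iff_true]
      constructor
      · rintro ⟨⟨rfl, h⟩, h'⟩
        exact ⟨v, ⟨h, h'⟩, rfl, rfl⟩
      · rintro ⟨v, ⟨h, h'⟩, rfl, rfl⟩
        exact ⟨⟨rfl, h⟩, h'⟩
    rw [← key, ← key]
    exact h1 _ _
  · have key : ∀ b, {p : A × B | (p.2, R p.1 p.2) = (y, True) ∧ c p = b}.ncard =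
        {x | R x y ∧ c (x, y) = b}.ncard := by
      intro b
      rw [← Set.ncard_image_of_injective {x | R x y ∧ c (x, y) = b}
        (Prod.mk_left_injective y)]
      refine congrArg Set.ncard (Set.ext fun ⟨u, v⟩ => ?_)
      simp only [Set.mem_ofPred_eq, Set.mem_image, Prod.mk.injEq, eq_iff_iff, iff_true]
      constructor
      · rintro ⟨⟨rfl, h⟩, h'⟩
        exact ⟨u, ⟨h, h'⟩, rfl, rfl⟩
      · rintro ⟨u, ⟨h, h'⟩, rfl, rfl⟩
        exact ⟨⟨rfl, h⟩, h'⟩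
    rw [← key, ← key]
    exact h2 _ _

/-- A finite graph splits into two edge-disjoint spanning subgraphs in each of which every vertex
keeps half of its degree, up to an error of one. -/
theorem SimpleGraph.exists_halving {V : Type*} [Finite V] (G : SimpleGraph V) :
    ∃ H : Bool → SimpleGraph V, (∀ b, H b ≤ G) ∧ Disjoint (H true) (H false) ∧
      ∀ b v, (G.neighborSet v).ncard ≤ 2 * ((H b).neighborSet v).ncard + 2 := by
  classical
  obtain ⟨n, ⟨e⟩⟩ := Finite.exists_equiv_fin V
  let _ : LinearOrder V := LinearOrder.lift' e e.injective
  obtain ⟨c, h1, h2⟩ := exists_balanced_coloring_rel (fun u v : V => u < v ∧ G.Adj u v)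
  let H : Bool → SimpleGraph V := fun b =>
    { Adj := fun u v => G.Adj u v ∧ (if u < v then c u v else c v u) = b
      symm := ⟨fun u v h => by
        have := h.1.ne
        refine ⟨h.1.symm, ?_⟩
        have h' := h.2
        rcases lt_or_gt_of_ne this with hlt | hlt
        · simpa [hlt, hlt.not_gt] using h'
        · simpa [hlt, hlt.not_gt] using h'⟩
      loopless := ⟨fun u h => h.1.ne rfl⟩ }
  have hdeg : ∀ b v, ((H b).neighborSet v).ncard =
      {u | (v < u ∧ G.Adj v u) ∧ c v u = b}.ncard +
        {u | (u < v ∧ G.Adj u v) ∧ c u v = b}.ncard := by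
    intro b v
    rw [← Set.ncard_union_eq]
    · congr 1
      ext u
      simp only [H, SimpleGraph.mem_neighborSet, Set.mem_union, Set.mem_ofPred_eq]
      have hne : G.Adj v u → v ≠ u := fun h => h.ne
      have hcomm := G.adj_comm u v
      grind
    · rw [Set.disjoint_left]
      rintro u ⟨⟨h, -⟩, -⟩ ⟨⟨h', -⟩, -⟩
      exact lt_asymm h h'
  refine ⟨H, fun b u v h => h.1, ?_, ?_⟩
  · rw [SimpleGraph.disjoint_left]
    rintro u v ⟨-, h⟩ ⟨-, h'⟩
    rw [h] at h'
    cases h'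
  · intro b v
    have hsub : G.neighborSet v ⊆ (H b).neighborSet v ∪ (H !b).neighborSet v := by
      intro u hu
      by_cases hb : (if v < u then c v u else c u v) = b
      · exact Or.inl ⟨hu, hb⟩
      · exact Or.inr ⟨hu, Bool.eq_not_of_ne hb⟩
    have hle := (Set.ncard_le_ncard hsub).trans (Set.ncard_union_le _ _)
    have e1 := hdeg b v
    have e2 := hdeg (!b) v
    have r1 := h1 v (!b)
    have r2 := h2 v (!b)
    rw [Bool.not_not] at r1 r2
    omega

/-- After halving `s` of the `2 ^ t` parts obtained by `t` rounds of halving, the parts with index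
below `s` or at least `2 ^ t` have been halved `t + 1` times and the others `t` times. -/
theorem SimpleGraph.exists_iterated_halving {V : Type*} [Finite V] (G : SimpleGraph V)
    (t s : ℕ) (hs : s ≤ 2 ^ t) :
    ∃ H : ℕ → SimpleGraph V, (∀ i, H i ≤ G) ∧
      (∀ i < 2 ^ t + s, ∀ j < 2 ^ t + s, i ≠ j → Disjoint (H i) (H j)) ∧
      ∀ i < 2 ^ t + s, ∀ v, (G.neighborSet v).ncard + 2 ≤
        2 ^ (if i < s ∨ 2 ^ t ≤ i then t + 1 else t) * (((H i).neighborSet v).ncard + 2) := by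
  have step : ∀ t, (∃ H : ℕ → SimpleGraph V, (∀ i, H i ≤ G) ∧
      (∀ i < 2 ^ t, ∀ j < 2 ^ t, i ≠ j → Disjoint (H i) (H j)) ∧
      ∀ i < 2 ^ t, ∀ v, (G.neighborSet v).ncard + 2 ≤
        2 ^ t * (((H i).neighborSet v).ncard + 2)) → ∀ s ≤ 2 ^ t,
      ∃ H : ℕ → SimpleGraph V, (∀ i, H i ≤ G) ∧
      (∀ i < 2 ^ t + s, ∀ j < 2 ^ t + s, i ≠ j → Disjoint (H i) (H j)) ∧
      ∀ i < 2 ^ t + s, ∀ v, (G.neighborSet v).ncard + 2 ≤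
        2 ^ (if i < s ∨ 2 ^ t ≤ i then t + 1 else t) * (((H i).neighborSet v).ncard + 2) := by
    intro t h0 s
    induction s with
    | zero =>
      intro _
      obtain ⟨H, hG, hd, hv⟩ := h0
      refine ⟨H, hG, hd, fun i hi => ?_⟩
      rw [if_neg (by simpa using hi)]
      exact hv i hi
    | succ s ih =>
      intro hs
      obtain ⟨H, hG, hd, hv⟩ := ih (by omega)
      obtain ⟨K, hK, hKd, hKv⟩ := (H s).exists_halving
      let L : ℕ → SimpleGraph V := fun i =>
        if i = s then K true else if i = 2 ^ t + s then K false else H i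
      have hL₁ : L s = K true := if_pos rfl
      have hL₂ : L (2 ^ t + s) = K false := by
        have : 0 < 2 ^ t := by positivity
        simp [L]
      have hL₃ : ∀ i, i ≠ s → i ≠ 2 ^ t + s → L i = H i := fun i h h' => by simp [L, h, h']
      have hsplit : ∀ i < 2 ^ t + (s + 1), i = s ∨ i = 2 ^ t + s ∨
          (i ≠ s ∧ i ≠ 2 ^ t + s ∧ i < 2 ^ t + s) := by omega
      have hKs : ∀ b v, (G.neighborSet v).ncard + 2 ≤
          2 ^ (t + 1) * (((K b).neighborSet v).ncard + 2) := by
        intro b v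
        have h1 := hv s (by omega) v
        rw [if_neg (by omega)] at h1
        have h2 := hKv b v
        calc _ ≤ _ := h1
          _ ≤ 2 ^ t * (2 * (((K b).neighborSet v).ncard + 2)) :=
            Nat.mul_le_mul_left _ (by omega)
          _ = _ := by ring
      refine ⟨L, ?_, ?_, ?_⟩
      · intro i
        simp only [L]
        split_ifs
        exacts [(hK _).trans (hG s), (hK _).trans (hG s), hG i]
      · have hKH : ∀ b, ∀ j < 2 ^ t + s, j ≠ s → Disjoint (K b) (H j) := fun b j hj hne =>
          (hd s (by omega) j hj hne.symm).mono_left (hK b)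
        intro i hi j hj hij
        rcases hsplit i hi with rfl | rfl | ⟨hi1, hi2, hi3⟩ <;>
          rcases hsplit j hj with rfl | rfl | ⟨hj1, hj2, hj3⟩
        · exact absurd rfl hij
        · rw [hL₁, hL₂]; exact hKd
        · rw [hL₁, hL₃ j hj1 hj2]; exact hKH _ _ hj3 hj1
        · rw [hL₁, hL₂]; exact hKd.symm
        · exact absurd rfl hij
        · rw [hL₂, hL₃ j hj1 hj2]; exact hKH _ _ hj3 hj1
        · rw [hL₁, hL₃ i hi1 hi2]; exact (hKH _ _ hi3 hi1).symm
        · rw [hL₂, hL₃ i hi1 hi2]; exact (hKH _ _ hi3 hi1).symm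
        · rw [hL₃ i hi1 hi2, hL₃ j hj1 hj2]; exact hd i hi3 j hj3 hij
      · intro i hi v
        rcases hsplit i hi with rfl | rfl | ⟨hi1, hi2, hi3⟩
        · rw [hL₁, if_pos (by omega)]; exact hKs _ _
        · rw [hL₂, if_pos (by omega)]; exact hKs _ _
        · rw [hL₃ i hi1 hi2]
          have h := hv i hi3 v
          have hiff : (i < s + 1 ∨ 2 ^ t ≤ i) ↔ (i < s ∨ 2 ^ t ≤ i) := by omega
          simpa only [hiff] using h
  refine step t ?_ s hs
  clear hs s
  induction t with
  | zero =>
    refine ⟨fun _ => G, fun _ => le_rfl, fun i hi j hj hij => ?_, by simp⟩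
    exact absurd (by simp at hi hj; omega) hij
  | succ t ih =>
    obtain ⟨H, hG, hd, hv⟩ := step t ih (2 ^ t) le_rfl
    have hpow : 2 ^ (t + 1) = 2 ^ t + 2 ^ t := by ring
    refine ⟨H, hG, by rwa [hpow], fun i hi v => ?_⟩
    have h := hv i (by omega) v
    rwa [if_pos (by omega)] at h

theorem stmt3 {V : Type*} [Fintype V] (G : SimpleGraph V) (δ : ℕ)
    (hδ : ∀ v : V, δ ≤ (G.neighborSet v).ncard)
    (k t s : ℕ) (hk : 1 ≤ k) (ht₁ : 2 ^ t ≤ k) (ht₂ : k < 2 ^ (t + 1))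
    (hs : s = k - 2 ^ t) :
    ∃ H : Fin k → SimpleGraph V, ∃ A : Finset (Fin k),
      (∀ i, H i ≤ G) ∧
      (∀ i j, i ≠ j → Disjoint (H i).edgeSet (H j).edgeSet) ∧
      A.card = 2 * s ∧
      (∀ i ∈ A, ∀ v : V,
        ((δ : ℝ) - 2 ^ (t + 2) + 2) / 2 ^ (t + 1) ≤ (((H i).neighborSet v).ncard : ℝ)) ∧
      (∀ i ∉ A, ∀ v : V,
        ((δ : ℝ) - 2 ^ (t + 1) + 2) / 2 ^ t ≤ (((H i).neighborSet v).ncard : ℝ)) := by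
  have hpow : 2 ^ (t + 1) = 2 ^ t + 2 ^ t := by ring
  obtain rfl : k = 2 ^ t + s := by omega
  obtain ⟨H, hG, hd, hv⟩ := G.exists_iterated_halving t s (by omega)
  have hreal : ∀ (i v) (m : ℕ), (G.neighborSet v).ncard + 2 ≤
      2 ^ m * (((H i).neighborSet v).ncard + 2) →
      ((δ : ℝ) - 2 ^ (m + 1) + 2) / 2 ^ m ≤ (((H i).neighborSet v).ncard : ℝ) := by
    intro i v m h
    have h' : δ + 2 ≤ 2 ^ m * (((H i).neighborSet v).ncard + 2) :=
      (Nat.add_le_add_right (hδ v) 2).trans h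
    have h'' : (δ : ℝ) + 2 ≤ 2 ^ m * ((((H i).neighborSet v).ncard : ℝ) + 2) := by
      exact_mod_cast h'
    rw [div_le_iff₀ (by positivity), pow_succ]
    linarith
  refine ⟨fun i => H i, Finset.univ.filter fun i => i.val < s ∨ 2 ^ t ≤ i.val, fun i => hG i,
    fun i j hij => ?_, ?_, fun i hi v => ?_, fun i hi v => ?_⟩
  · exact SimpleGraph.disjoint_edgeSet.2 (hd i i.2 j j.2 (Fin.val_ne_of_ne hij))
  · rw [← Finset.card_map Fin.valEmbedding]
    have : (Finset.univ.filter fun i : Fin (2 ^ t + s) => i.val < s ∨ 2 ^ t ≤ i.val).map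
        Fin.valEmbedding = Finset.range s ∪ Finset.Ico (2 ^ t) (2 ^ t + s) := by
      ext x
      simp only [Finset.mem_map, Finset.mem_filter, Finset.mem_univ, true_and,
        Fin.valEmbedding_apply, Finset.mem_union, Finset.mem_range, Finset.mem_Ico]
      constructor
      · rintro ⟨i, hi, rfl⟩
        have := i.2
        omega
      · intro hx
        exact ⟨⟨x, by omega⟩, by simp only; omega, rfl⟩
    rw [this, Finset.card_union_of_disjoint]
    · simp; omega
    · rw [Finset.disjoint_left]
      intro x hx hx'
      simp only [Finset.mem_range, Finset.mem_Ico] at hx hx'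
      omega
  · have h := hv i i.2 v
    rw [if_pos (by simpa using hi)] at h
    exact hreal i v (t + 1) h
  · have h := hv i i.2 v
    rw [if_neg (by simpa using hi)] at h
    exact hreal i v t h
end

section
/- Let G be a connected graph on n vertices with minimum degree δ, let k ≥ 1, and let t be the integer with 2^t ≤ k < 2^{t+1}. If δ ≥ 2^{t+1} - 1 then rx_k(G) < 10·n·k·2^t/(δ - 2^{t+1} + 2) - k - 2. -/
open SimpleGraph

/-- An edge-coloring `c` is a `k`-rainbow coloring of `G` if every set of `k` vertices
is connected by a rainbow tree (here: a connected subgraph whose edges receive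
pairwise distinct colors). -/
def IsKRainbowColoring {V : Type*} (G : SimpleGraph V) (k : ℕ) (c : Sym2 V → ℕ) : Prop :=
  ∀ S : Finset V, S.card = k →
    ∃ T : G.Subgraph, T.Connected ∧ ↑S ⊆ T.verts ∧ Set.InjOn c T.edgeSet

/-- The `k`-rainbow index: minimum number of colors in a `k`-rainbow coloring. -/
noncomputable def rxk {V : Type*} (G : SimpleGraph V) (k : ℕ) : ℕ :=
  sInf {m | ∃ c : Sym2 V → ℕ, (∀ e ∈ G.edgeSet, c e < m) ∧ IsKRainbowColoring G k c}

/-- If all degrees are at least `2kq`, the edges can be labelled with `k` labels so that every vertex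
is incident with at least `q` edges of each label. -/
theorem exists_edge_labelling {V : Type*} [Fintype V] (G : SimpleGraph V) {k q : ℕ} (hk : 0 < k)
    (h : ∀ v, 2 * (k * q) ≤ (G.neighborSet v).ncard) :
    ∃ l : Sym2 V → Fin k, ∀ v i, q ≤ {w | G.Adj v w ∧ l s(v, w) = i}.ncard := by
  classical
  have hdeg : ∀ v, 2 * (k * q) ≤ (G.incidenceFinset v).card := by
    intro v
    rw [card_incidenceFinset_eq_degree, ← card_neighborFinset_eq_degree, neighborFinset,
      ← Set.ncard_eq_toFinset_card']
    exact h v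
  obtain ⟨f, hf, hft⟩ := (Finset.all_card_le_biUnion_card_iff_exists_injective
    (fun x : V × Fin k × Fin q => G.incidenceFinset x.1)).1 (by
      intro s
      have h1 : s.card ≤ (s.image Prod.fst).card * (k * q) := by
        refine (Finset.card_le_card (t := (s.image Prod.fst) ×ˢ Finset.univ) ?_).trans ?_
        · intro x hx
          simp only [Finset.mem_product, Finset.mem_univ, and_true]
          exact Finset.mem_image_of_mem _ hx
        · simp
      have h2 := Finset.card_mul_le_card_mul (s := s.image Prod.fst)
        (t := s.biUnion fun x => G.incidenceFinset x.1) (fun v e => v ∈ e)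
        (m := 2 * (k * q)) (n := 2) (by
          intro v hv
          obtain ⟨x, hx, rfl⟩ := Finset.mem_image.1 hv
          refine (hdeg x.1).trans (Finset.card_le_card fun e he => ?_)
          rw [Finset.mem_bipartiteAbove]
          exact ⟨Finset.mem_biUnion.2 ⟨x, hx, he⟩, ((G.mem_incidenceFinset x.1 e).1 he).2⟩) (by
          intro e _
          refine (Finset.card_le_card (t := e.toFinset) fun v hv => ?_).trans ?_
          · rw [Finset.mem_bipartiteBelow] at hv
            simpa using hv.2
          · rw [Sym2.card_toFinset]
            split_ifs <;> omega)
      nlinarith)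
  have hadj : ∀ x, ∃ w, G.Adj x.1 w ∧ f x = s(x.1, w) := by
    intro x
    obtain ⟨he, hv⟩ := (G.mem_incidenceFinset x.1 (f x)).1 (hft x)
    obtain ⟨w, hw⟩ := hv
    exact ⟨w, by rwa [hw] at he, hw⟩
  choose g hg hfg using hadj
  refine ⟨fun e => if he : ∃ x, f x = e then he.choose.2.1 else ⟨0, hk⟩, fun v i => ?_⟩
  have hl : ∀ x, (if he : ∃ y, f y = f x then he.choose.2.1 else ⟨0, hk⟩) = x.2.1 := by
    intro x
    have he : ∃ y, f y = f x := ⟨x, rfl⟩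
    rw [dif_pos he, hf he.choose_spec]
  have hinj : Function.Injective fun j : Fin q => g (v, i, j) := by
    intro j j' hj
    have : f (v, i, j) = f (v, i, j') := by
      rw [hfg, hfg]
      simp only at hj
      rw [hj]
    simpa using hf this
  calc q = (Set.range fun j : Fin q => g (v, i, j)).ncard := by
        rw [← Set.image_univ, Set.ncard_image_of_injective _ hinj]
        simp
    _ ≤ _ := by
        refine Set.ncard_le_ncard ?_ (Set.toFinite _)
        rintro _ ⟨j, rfl⟩
        refine ⟨hg (v, i, j), ?_⟩
        have := hl (v, i, j)
        rw [hfg (v, i, j)] at this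
        exact this

/-- A graph of minimum degree at least `q` on `n` vertices has a set of at most `n / (q + 1)` vertices
such that every vertex is within distance two of it. -/
theorem exists_two_step_dominating {V : Type*} [Fintype V] (H : SimpleGraph V) {q : ℕ}
    (h : ∀ v, q ≤ (H.neighborSet v).ncard) :
    ∃ S : Finset V, S.card * (q + 1) ≤ Fintype.card V ∧
      ∀ v, ∃ s ∈ S, ∃ p : H.Walk v s, p.length ≤ 2 := by
  classical
  let B : V → Finset V := fun v => insert v (H.neighborFinset v)
  have hB : ∀ v, q + 1 ≤ (B v).card := by
    intro v
    rw [Finset.card_insert_of_notMem (by simp), neighborFinset, ← Set.ncard_eq_toFinset_card']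
    exact Nat.succ_le_succ (h v)
  obtain ⟨S, hS, hmax⟩ := Finset.exists_max_image
    (Finset.univ.filter fun S : Finset V => (S : Set V).PairwiseDisjoint B) Finset.card
    ⟨∅, by simp⟩
  simp only [Finset.mem_filter, Finset.mem_univ, true_and] at hS hmax
  refine ⟨S, ?_, fun v => ?_⟩
  · calc S.card * (q + 1) ≤ ∑ s ∈ S, (B s).card := by
          rw [← smul_eq_mul]
          exact Finset.card_nsmul_le_sum _ _ _ fun s _ => hB s
      _ = (S.biUnion B).card := (Finset.card_biUnion hS).symm
      _ ≤ _ := Finset.card_le_univ _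
  · by_cases hv : v ∈ S
    · exact ⟨v, hv, .nil, by simp⟩
    have hex : ∃ s ∈ S, ¬ Disjoint (B v) (B s) := by
      by_contra! hcon
      have h1 := hmax (insert v S) (by
        rw [Finset.coe_insert]
        exact hS.insert fun s hs _ => hcon s hs)
      rw [Finset.card_insert_of_notMem hv] at h1
      omega
    obtain ⟨s, hs, hd⟩ := hex
    obtain ⟨w, hwv, hws⟩ := Finset.not_disjoint_iff.1 hd
    refine ⟨s, hs, ?_⟩
    simp only [B, Finset.mem_insert, mem_neighborFinset] at hwv hws
    rcases hwv with rfl | hwv <;> rcases hws with rfl | hws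
    · exact ⟨.nil, by simp⟩
    · exact ⟨.cons hws.symm .nil, by simp⟩
    · exact ⟨.cons hwv .nil, by simp⟩
    · exact ⟨.cons hwv (.cons hws.symm .nil), by simp⟩

theorem ncard_edgeSet_sup_toSubgraph_le {V : Type*} {G : SimpleGraph V} (T : G.Subgraph) {x y : V}
    (p : G.Walk x y) :
    (T ⊔ p.toSubgraph).edgeSet.ncard ≤ T.edgeSet.ncard + p.length := by
  classical
  rw [Subgraph.edgeSet_sup, Walk.edgeSet_toSubgraph]
  refine (Set.ncard_union_le _ _).trans (Nat.add_le_add_left ?_ _)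
  rw [← p.length_edges, ← Walk.coe_edges_toFinset, Set.ncard_coe_finset]
  exact List.toFinset_card_le _

theorem connected_sup_toSubgraph {V : Type*} {G : SimpleGraph V} {T : G.Subgraph} {x y z : V}
    (hT : T.Connected) (p : G.Walk x y) (hz : z ∈ T.verts) (hzp : z ∈ p.support) :
    (T ⊔ p.toSubgraph).Connected :=
  Subgraph.connected_sup hT.preconnected p.toSubgraph_connected.preconnected
    ⟨z, hz, by simpa using hzp⟩

/-- A set `A` such that every vertex is within distance two of it spans a connected subgraph with
at most `5 (|A| - 1)` edges. -/
theorem exists_connected_of_two_step_dominating {V : Type*} [Fintype V] {G : SimpleGraph V}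
    (hG : G.Connected) (A : Finset V) (hA : ∀ v, ∃ s ∈ A, ∃ p : G.Walk v s, p.length ≤ 2) :
    ∃ T : G.Subgraph, T.Connected ∧ ↑A ⊆ T.verts ∧ T.edgeSet.ncard + 5 ≤ 5 * A.card := by
  classical
  obtain ⟨v₀⟩ := hG.nonempty
  obtain ⟨a₀, ha₀, -⟩ := hA v₀
  have key : ∀ m, m < A.card → ∃ A' ⊆ A, A'.card = m + 1 ∧ ∃ T : G.Subgraph, T.Connected ∧
      ↑A' ⊆ T.verts ∧ T.edgeSet.ncard ≤ 5 * m := by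
    intro m
    induction m with
    | zero =>
      intro _
      exact ⟨{a₀}, by simpa using ha₀, by simp, G.singletonSubgraph a₀,
        Subgraph.singletonSubgraph_connected, by simp, by simp⟩
    | succ m ih =>
      intro hm
      obtain ⟨A', hA', hcard, T, hT, hAT, hTe⟩ := ih (by omega)
      have hne : A'.Nonempty := Finset.card_pos.1 (by omega)
      obtain ⟨b, hb, hbA⟩ := Finset.exists_mem_notMem_of_card_lt_card (s := A') (t := A) (by omega)
      obtain ⟨a', ha'⟩ := hne
      have hex : ∃ x ∈ A', ∃ y ∈ A, y ∉ A' ∧ ∃ p : G.Walk x y, p.length ≤ 5 := by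
        by_cases hall : ∃ s ∈ A', ∃ p : G.Walk b s, p.length ≤ 2
        · obtain ⟨s, hs, p, hp⟩ := hall
          exact ⟨s, hs, b, hb, hbA, p.reverse, by rw [Walk.length_reverse]; omega⟩
        obtain ⟨P⟩ := hG.preconnected a' b
        obtain ⟨d, -, ⟨s, hs, p, hp⟩, hd2⟩ := P.exists_boundary_dart
          {v | ∃ s ∈ A', ∃ p : G.Walk v s, p.length ≤ 2} ⟨a', ha', .nil, by simp⟩ hall
        obtain ⟨y, hy, r, hr⟩ := hA d.snd
        refine ⟨s, hs, y, hy, fun hyA => hd2 ⟨y, hyA, r, hr⟩,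
          p.reverse.append (.cons d.adj r), ?_⟩
        rw [Walk.length_append, Walk.length_reverse, Walk.length_cons]
        omega
      obtain ⟨x, hx, y, hy, hyA, p, hp⟩ := hex
      refine ⟨insert y A', Finset.insert_subset hy hA', ?_, T ⊔ p.toSubgraph,
        connected_sup_toSubgraph hT p (hAT hx) p.start_mem_support, ?_, ?_⟩
      · rw [Finset.card_insert_of_notMem hyA, hcard]
      · rw [Finset.coe_insert, Subgraph.verts_sup, Set.insert_subset_iff]
        exact ⟨Or.inr (by simp), hAT.trans Set.subset_union_left⟩
      · have := ncard_edgeSet_sup_toSubgraph_le T p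
        omega
  have hpos : 0 < A.card := Finset.card_pos.2 ⟨a₀, ha₀⟩
  obtain ⟨A', hA', hcard, T, hT, hAT, hTe⟩ := key (A.card - 1) (by omega)
  obtain rfl := Finset.eq_of_subset_of_card_le hA' (by omega)
  exact ⟨T, hT, hAT, by omega⟩

theorem exists_connected_extension {V : Type*} {G : SimpleGraph V}
    {T : G.Subgraph} (hT : T.Connected)
    (hdom : ∀ v, ∃ s ∈ T.verts, ∃ p : G.Walk v s, p.length ≤ 2) (B : Finset V) :
    ∃ T' : G.Subgraph, T'.Connected ∧ T ≤ T' ∧ ↑B ⊆ T'.verts ∧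
      T'.edgeSet.ncard ≤ T.edgeSet.ncard + 2 * B.card := by
  classical
  induction B using Finset.induction_on with
  | empty => exact ⟨T, hT, le_rfl, by simp, by simp⟩
  | insert b B hb ih =>
    obtain ⟨T', hT', hle, hB, hcard⟩ := ih
    obtain ⟨s, hs, p, hp⟩ := hdom b
    refine ⟨T' ⊔ p.toSubgraph,
      connected_sup_toSubgraph hT' p (Subgraph.verts_mono hle hs) p.end_mem_support,
      hle.trans le_sup_left, ?_, ?_⟩
    · rw [Finset.coe_insert, Subgraph.verts_sup, Set.insert_subset_iff]
      exact ⟨Or.inr (by simp), hB.trans Set.subset_union_left⟩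
    · have := ncard_edgeSet_sup_toSubgraph_le T' p
      rw [Finset.card_insert_of_notMem hb]
      omega

theorem exists_connected_sup_walks {V ι : Type*} {G : SimpleGraph V}
    {T : G.Subgraph} (hT : T.Connected) (x y : ι → V) (p : ∀ i, G.Walk (x i) (y i))
    (hy : ∀ i, y i ∈ T.verts) (J : Finset ι) :
    ∃ T' : G.Subgraph, T'.Connected ∧ (∀ i ∈ J, x i ∈ T'.verts) ∧
      ∀ e ∈ T'.edgeSet, e ∈ T.edgeSet ∨ ∃ i ∈ J, e ∈ (p i).edges := by
  classical
  suffices ∃ T' : G.Subgraph, T ≤ T' ∧ T'.Connected ∧ (∀ i ∈ J, x i ∈ T'.verts) ∧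
      ∀ e ∈ T'.edgeSet, e ∈ T.edgeSet ∨ ∃ i ∈ J, e ∈ (p i).edges by
    obtain ⟨T', -, h⟩ := this
    exact ⟨T', h⟩
  induction J using Finset.induction_on with
  | empty => exact ⟨T, le_rfl, hT, by simp, fun e he => Or.inl he⟩
  | insert j J hj ih =>
    obtain ⟨T', hle, hT', hx, he⟩ := ih
    refine ⟨T' ⊔ (p j).toSubgraph, hle.trans le_sup_left,
      connected_sup_toSubgraph hT' (p j) (Subgraph.verts_mono hle (hy j)) (p j).end_mem_support,
      ?_, ?_⟩
    · intro i hi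
      rw [Subgraph.verts_sup]
      rcases Finset.mem_insert.1 hi with rfl | hi
      · exact Or.inr (by simp)
      · exact Or.inl (hx i hi)
    · intro e hee
      rw [Subgraph.edgeSet_sup, Walk.edgeSet_toSubgraph] at hee
      rcases hee with hee | hee
      · rcases he e hee with h | ⟨i, hi, h⟩
        · exact Or.inl h
        · exact Or.inr ⟨i, Finset.mem_insert_of_mem hi, h⟩
      · exact Or.inr ⟨j, Finset.mem_insert_self _ _, hee⟩

theorem exists_walk_to_dominating {V : Type*} {H : SimpleGraph V} {S : Finset V} {v s : V}
    (hs : s ∈ S) (p : H.Walk v s) (hp : p.length ≤ 2) :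
    ∃ s' ∈ S, ∃ p' : H.Walk v s', ∀ e ∈ p'.edges, ∀ e' ∈ p'.edges,
      ((∃ x ∈ S, x ∈ e) ↔ ∃ x ∈ S, x ∈ e') → e = e' := by
  by_cases hv : v ∈ S
  · exact ⟨v, hv, .nil, by simp⟩
  match p, hp with
  | .nil, _ => exact absurd hs hv
  | .cons h .nil, _ => exact ⟨s, hs, .cons h .nil, by simp⟩
  | .cons (v := w) h (.cons h' .nil), _ =>
    by_cases hw : w ∈ S
    · exact ⟨w, hw, .cons h .nil, by simp⟩
    · refine ⟨s, hs, .cons h (.cons h' .nil), ?_⟩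
      have h1 : ¬ ∃ x ∈ S, x ∈ s(v, w) := by
        rintro ⟨x, hx, hxe⟩
        rcases Sym2.mem_iff.1 hxe with rfl | rfl
        · exact hv hx
        · exact hw hx
      have h2 : ∃ x ∈ S, x ∈ s(w, s) := ⟨s, hs, by simp⟩
      intro e he e' he' hee
      simp only [Walk.edges_cons, Walk.edges_nil, List.mem_cons, List.not_mem_nil, or_false]
        at he he'
      rcases he with rfl | rfl <;> rcases he' with rfl | rfl
      · rfl
      · exact absurd (hee.2 h2) h1
      · exact absurd (hee.1 h2) h1
      · rfl
  | .cons _ (.cons _ (.cons _ _)), hp => simp at hp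

/-- The subgraph formed by the edges of `G` with label `i`. -/
def labelGraph {V ι : Type*} (G : SimpleGraph V) (l : Sym2 V → ι) (i : ι) : SimpleGraph V where
  Adj v w := G.Adj v w ∧ l s(v, w) = i
  symm := ⟨fun v w h => ⟨h.1.symm, by rw [Sym2.eq_swap]; exact h.2⟩⟩
  loopless := ⟨fun v h => G.loopless.irrefl v h.1⟩

theorem labelGraph_le {V ι : Type*} (G : SimpleGraph V) (l : Sym2 V → ι) (i : ι) :
    labelGraph G l i ≤ G := fun _ _ h => h.1

theorem label_eq_of_mem_edgeSet {V ι : Type*} {G : SimpleGraph V} {l : Sym2 V → ι} {i : ι}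
    {e : Sym2 V} (he : e ∈ (labelGraph G l i).edgeSet) : l e = i := by
  induction e with
  | h v w => exact he.2

theorem exists_rainbow_core {V : Type*} [Fintype V] {G : SimpleGraph V} (hG : G.Connected)
    {k q : ℕ} (S : Fin (k + 1) → Finset V) (hS : ∀ i, (S i).card * (q + 1) ≤ Fintype.card V)
    (hdom : ∀ v, ∃ s ∈ S 0, ∃ p : G.Walk v s, p.length ≤ 2) :
    ∃ T : G.Subgraph, T.Connected ∧ (∀ i, ↑(S i) ⊆ T.verts) ∧
      (T.edgeSet.ncard + 5) * (q + 1) ≤ (2 * k + 5) * Fintype.card V := by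
  classical
  obtain ⟨T, hT, hST, hTe⟩ := exists_connected_of_two_step_dominating hG (S 0) hdom
  obtain ⟨T', hT', hle, hB, hcard⟩ := exists_connected_extension hT
    (fun v => by
      obtain ⟨s, hs, p, hp⟩ := hdom v
      exact ⟨s, hST hs, p, hp⟩)
    (Finset.univ.biUnion fun i : Fin k => S i.succ)
  refine ⟨T', hT', fun i => ?_, ?_⟩
  · induction i using Fin.cases with
    | zero => exact hST.trans (Subgraph.verts_mono hle)
    | succ i => exact fun x hx => hB (Finset.mem_coe.2
        (Finset.mem_biUnion.2 ⟨i, Finset.mem_univ _, hx⟩))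
  · have hsum : (Finset.univ.biUnion fun i : Fin k => S i.succ).card * (q + 1) ≤
        k * Fintype.card V := by
      refine (Nat.mul_le_mul_right _ Finset.card_biUnion_le).trans ?_
      rw [Finset.sum_mul]
      refine (Finset.sum_le_card_nsmul _ _ _ fun i _ => hS i.succ).trans ?_
      simp
    nlinarith [hS 0]

/-- The number of colors of the construction: a core with pairwise distinct colors and two more
colors for each of `k` edge-disjoint subgraphs. -/
theorem exists_rxk_le {V : Type*} [Fintype V] {G : SimpleGraph V} (hG : G.Connected)
    {k q : ℕ} (hk : 0 < k) (h : ∀ v, 2 * (k * q) ≤ (G.neighborSet v).ncard) :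
    ∃ E, rxk G k ≤ E + 2 * k ∧ (E + 5) * (q + 1) ≤ (2 * k + 3) * Fintype.card V := by
  classical
  obtain ⟨l, hl⟩ := exists_edge_labelling G hk h
  choose S hS hdom using fun i => exists_two_step_dominating (labelGraph G l i) fun v => hl v i
  obtain ⟨k, rfl⟩ : ∃ k', k = k' + 1 := ⟨k - 1, by omega⟩
  obtain ⟨C, hC, hSC, hCard⟩ := exists_rainbow_core hG S hS fun v => by
    obtain ⟨s, hs, p, hp⟩ := hdom 0 v
    exact ⟨s, hs, p.mapLe (labelGraph_le G l 0), by simpa using hp⟩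
  refine ⟨C.edgeSet.ncard, ?_, by linarith⟩
  obtain ⟨φ⟩ : Nonempty (C.edgeSet ≃ Fin C.edgeSet.ncard) :=
    ⟨Finite.equivFinOfCardEq rfl⟩
  let g : Sym2 V → ℕ := fun e => 2 * (l e : ℕ) + if ∃ x ∈ S (l e), x ∈ e then 0 else 1
  have hg : ∀ e, g e = 2 * (l e : ℕ) + if ∃ x ∈ S (l e), x ∈ e then 0 else 1 := fun _ => rfl
  let c : Sym2 V → ℕ := fun e =>
    if he : e ∈ C.edgeSet then (φ ⟨e, he⟩ : ℕ) else C.edgeSet.ncard + g e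
  have hc₁ : ∀ e (he : e ∈ C.edgeSet), c e = φ ⟨e, he⟩ := fun e he => dif_pos he
  have hc₂ : ∀ e, e ∉ C.edgeSet → c e = C.edgeSet.ncard + g e := fun e he => dif_neg he
  refine Nat.sInf_le ⟨c, fun e _ => ?_, fun A hA => ?_⟩
  · by_cases he : e ∈ C.edgeSet
    · rw [hc₁ e he]
      have := (φ ⟨e, he⟩).2
      omega
    · rw [hc₂ e he, hg]
      have := (l e).2
      split_ifs <;> omega
  · have hwalk : ∀ i v, ∃ s ∈ S i, ∃ p : G.Walk v s, (∀ e ∈ p.edges, l e = i) ∧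
        ∀ e ∈ p.edges, ∀ e' ∈ p.edges, g e = g e' → e = e' := by
      intro i v
      obtain ⟨s, hs, p, hp⟩ := hdom i v
      obtain ⟨s, hs, p, hp⟩ := exists_walk_to_dominating hs p hp
      have hlab : ∀ e ∈ p.edges, l e = i := fun e he =>
        label_eq_of_mem_edgeSet (p.edges_subset_edgeSet he)
      refine ⟨s, hs, p.mapLe (labelGraph_le G l i), ?_, ?_⟩
      · simpa using hlab
      · simp only [Walk.edges_mapLe_eq_edges]
        intro e he e' he' hee
        refine hp e he e' he' ?_
        rw [hg, hg, hlab e he, hlab e' he'] at hee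
        split_ifs at hee with h1 h2 h2 <;> first | omega | simp only [h1, h2]
    choose y hy p hpl hpg using hwalk
    let x : Fin (k + 1) → V := fun i => (A.equivFinOfCardEq hA).symm i
    obtain ⟨T, hT, hxT, hTe⟩ := exists_connected_sup_walks hC x (fun i => y i (x i))
      (fun i => p i (x i)) (fun i => hSC i (hy i (x i))) Finset.univ
    refine ⟨T, hT, fun v hv => ?_, fun e he e' he' hee => ?_⟩
    · have := hxT (A.equivFinOfCardEq hA ⟨v, hv⟩) (Finset.mem_univ _)
      simpa [x] using this
    · by_cases h1 : e ∈ C.edgeSet <;> by_cases h2 : e' ∈ C.edgeSet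
      · rw [hc₁ e h1, hc₁ e' h2] at hee
        simpa using φ.injective (Fin.ext hee)
      · rw [hc₁ e h1, hc₂ e' h2] at hee
        have := (φ ⟨e, h1⟩).2
        omega
      · rw [hc₂ e h1, hc₁ e' h2] at hee
        have := (φ ⟨e', h2⟩).2
        omega
      · rw [hc₂ e h1, hc₂ e' h2] at hee
        obtain ⟨i, -, hi⟩ := (hTe e he).resolve_left h1
        obtain ⟨j, -, hj⟩ := (hTe e' he').resolve_left h2
        have hgg : g e = g e' := by omega
        have hij : i = j := by
          have := hgg
          rw [hg, hg, hpl _ _ _ hi, hpl _ _ _ hj] at this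
          apply Fin.ext
          split_ifs at this <;> omega
        subst hij
        exact hpg _ _ _ hi _ hj hgg

theorem color_count_lt {n δ k K E : ℝ} (hk : 1 ≤ k) (hkK : k + 1 ≤ 2 * K)
    (hk3 : 3 ≤ k ∨ k = 2 ∧ K = 2 ∨ k = 1) (hn : δ + 1 ≤ n) (hD : 0 < δ - 2 * K + 2)
    (hE : (E + 5) * (δ + 1) ≤ 2 * k * (2 * k + 3) * n) :
    E + 2 * k < 10 * n * k * K / (δ - 2 * K + 2) - k - 2 := by
  have hδ : 0 < δ + 1 := by linarith
  set D := δ - 2 * K + 2 with hDdef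
  have hDδ : D ≤ δ + 1 - k := by linarith
  have hn0 : 0 < n := by linarith
  have hE' : E + 5 ≤ 2 * k * (2 * k + 3) * n / (δ + 1) := by
    rwa [le_div_iff₀ hδ]
  suffices 2 * k * (2 * k + 3) * n / (δ + 1) + 3 * k - 3 < 10 * n * k * K / D by linarith
  have hm : 1 ≤ n / (δ + 1) := by rwa [le_div_iff₀ hδ, one_mul]
  have hmD : n / (δ + 1) < n / D := div_lt_div_of_pos_left hn0 hD (by linarith)
  have e1 : 2 * k * (2 * k + 3) * n / (δ + 1) = 2 * k * (2 * k + 3) * (n / (δ + 1)) := by ring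
  have e2 : 10 * n * k * K / D = 10 * k * K * (n / D) := by ring
  rw [e1, e2]
  generalize n / (δ + 1) = m at *
  generalize n / D = m' at *
  have hkK0 : 0 < 10 * k * K := by
    have : 0 < K := by linarith
    positivity
  have h1 : 10 * k * K * m < 10 * k * K * m' := mul_lt_mul_of_pos_left hmD hkK0
  have h2 : 5 * k * (k + 1) * m ≤ 10 * k * K * m := by
    have : 0 ≤ k * m := by positivity
    nlinarith
  rcases hk3 with hk3 | ⟨rfl, rfl⟩ | rfl
  · have : 3 * (k - 1) ≤ k * (k - 1) * m := by
      have : 0 ≤ k - 1 := by linarith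
      have : 3 * (k - 1) ≤ k * (k - 1) := by nlinarith
      nlinarith
    nlinarith
  · linarith
  · linarith

theorem stmt7 {V : Type*} [Fintype V] (G : SimpleGraph V) (hG : G.Connected)
    (n δ : ℕ) (hn : Fintype.card V = n)
    (hδ : ∀ v : V, δ ≤ (G.neighborSet v).ncard)
    (k t : ℕ) (hk : 1 ≤ k) (ht₁ : 2 ^ t ≤ k) (ht₂ : k < 2 ^ (t + 1))
    (hδt : 2 ^ (t + 1) - 1 ≤ δ) :
    (rxk G k : ℝ) <
      10 * n * k * 2 ^ t / ((δ : ℝ) - 2 ^ (t + 1) + 2) - k - 2 := by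
  classical
  subst hn
  set q := δ / (2 * k) with hq
  have hqδ : 2 * (k * q) ≤ δ := by
    rw [← mul_assoc]
    exact Nat.mul_div_le δ (2 * k)
  have hδq : δ + 1 ≤ 2 * k * (q + 1) := Nat.lt_mul_div_succ δ (by omega)
  obtain ⟨E, hE, hEn⟩ := exists_rxk_le hG hk fun v => hqδ.trans (hδ v)
  have hδn : δ + 1 ≤ Fintype.card V := by
    obtain ⟨v⟩ := hG.nonempty
    have h1 := Set.ncard_lt_card (s := G.neighborSet v)
      (fun h => G.loopless.irrefl v (h ▸ Set.mem_univ v : v ∈ G.neighborSet v))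
    rw [Nat.card_eq_fintype_card] at h1
    exact (Nat.succ_le_succ (hδ v)).trans h1
  have hEδ : (E + 5) * (δ + 1) ≤ 2 * k * (2 * k + 3) * Fintype.card V := by
    calc (E + 5) * (δ + 1) ≤ (E + 5) * (2 * k * (q + 1)) := Nat.mul_le_mul_left _ hδq
      _ = 2 * k * ((E + 5) * (q + 1)) := by ring
      _ ≤ 2 * k * ((2 * k + 3) * Fintype.card V) := Nat.mul_le_mul_left _ hEn
      _ = _ := by ring
  have hK : k = 2 → 2 ^ t = 2 := by
    rintro rfl
    match t, ht₁, ht₂ with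
    | 0, _, ht₂ => norm_num at ht₂
    | 1, _, _ => rfl
    | t + 2, ht₁, _ =>
      have := Nat.one_le_two_pow (n := t)
      rw [pow_add] at ht₁
      omega
  have hpow : 2 ^ (t + 1) = 2 * 2 ^ t := pow_succ' 2 t
  rw [hpow] at ht₂ hδt
  rw [pow_succ' (2 : ℝ) t]
  refine lt_of_le_of_lt (b := (E : ℝ) + 2 * k) (by exact_mod_cast hE) (color_count_lt ?_ ?_ ?_ ?_ ?_ ?_)
  · exact_mod_cast hk
  · exact_mod_cast ht₂
  · rcases Nat.lt_or_ge k 3 with h3 | h3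
    · rcases (by omega : k = 2 ∨ k = 1) with h2 | h1
      · exact Or.inr (Or.inl ⟨by exact_mod_cast h2, by exact_mod_cast hK h2⟩)
      · exact Or.inr (Or.inr (by exact_mod_cast h1))
    · exact Or.inl (by exact_mod_cast h3)
  · exact_mod_cast hδn
  · have : 2 * 2 ^ t ≤ δ + 1 := by omega
    have : (2 : ℝ) * 2 ^ t ≤ δ + 1 := by exact_mod_cast this
    linarith
  · exact_mod_cast hEδ
end
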